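/- Let U = (U_i)_{i≥0} be a strictly increasing sequence of positive integers satisfying a linear recurrence U_{i+k} = a_1 U_{i+k−1} + ⋯ + a_k U_i of order k with integer coefficients and a_k ≠ 0. Then the following are equivalent: (i) lim_{m→∞} N_U(m) = +∞; (ii) for every prime divisor p of a_k, lim_{v→∞} N_U(p^v) = +∞. In particular, if a_k = ±1, then lim_{m→∞} N_U(m) = +∞. -/

import Mathlib

open Filter

/-- `N_U(m)`: the number of residues mod `m` taken infinitely often by the
sequence `(U_i mod m)_{i ≥ 0}`. -/
noncomputable def Ninf (s : ℕ → ℕ) (m : ℕ) : ℕ :=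
  Set.ncard {r : ZMod m | ∀ N : ℕ, ∃ i, N ≤ i ∧ (s i : ZMod m) = r}

/-- The set of residues mod `m` taken infinitely often. -/
def infSet (s : ℕ → ℕ) (m : ℕ) : Set (ZMod m) :=
  {r : ZMod m | ∀ N : ℕ, ∃ i, N ≤ i ∧ (s i : ZMod m) = r}

lemma eventually_mem_infSet (s : ℕ → ℕ) (m : ℕ) [NeZero m] :
    ∃ N, ∀ i, N ≤ i → (s i : ZMod m) ∈ infSet s m := by
  have h : ∀ r : ZMod m, ∃ N, r ∈ infSet s m ∨ ∀ i, N ≤ i → (s i : ZMod m) ≠ r := by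
    intro r
    by_cases hr : r ∈ infSet s m
    · exact ⟨0, Or.inl hr⟩
    · simp only [infSet, Set.mem_setOf_eq, not_forall, not_exists, not_and] at hr
      obtain ⟨N, hN⟩ := hr
      exact ⟨N, Or.inr hN⟩
  choose N hN using h
  refine ⟨Finset.univ.sup N, fun i hi => ?_⟩
  rcases hN (s i : ZMod m) with h | h
  · exact h
  · exact absurd rfl (h i (le_trans (Finset.le_sup (f := N) (Finset.mem_univ _)) hi))

lemma Ninf_le_of_dvd (s : ℕ → ℕ) {d m : ℕ} (hd : d ∣ m) (hm : m ≠ 0) :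
    Ninf s d ≤ Ninf s m := by
  haveI : NeZero m := ⟨hm⟩
  obtain ⟨N, hN⟩ := eventually_mem_infSet s m
  have hsub : infSet s d ⊆ (ZMod.castHom hd (ZMod d)) '' infSet s m := by
    intro r hr
    obtain ⟨i, hi, hir⟩ := hr N
    exact ⟨(s i : ZMod m), hN i hi, by rw [map_natCast, hir]⟩
  calc Ninf s d = (infSet s d).ncard := rfl
    _ ≤ ((ZMod.castHom hd (ZMod d)) '' infSet s m).ncard :=
        Set.ncard_le_ncard hsub (Set.toFinite _)
    _ ≤ (infSet s m).ncard := Set.ncard_image_le (Set.toFinite _)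
    _ = Ninf s m := rfl

lemma mem_infSet_of_unit (U : ℕ → ℕ) (k : ℕ) (hk : 0 < k) (a : Fin k → ℤ)
    (hrec : ∀ i : ℕ, (U (i + k) : ℤ) = ∑ j : Fin k, a j * U (i + k - 1 - (j : ℕ)))
    (m : ℕ) [NeZero m]
    (hu : IsUnit ((a ⟨k - 1, Nat.sub_lt hk Nat.one_pos⟩ : ℤ) : ZMod m)) (i : ℕ) :
    (U i : ZMod m) ∈ infSet U m := by
  have hrec' : ∀ i : ℕ, (U (i + k) : ZMod m) =
      ∑ j : Fin k, ((a j : ℤ) : ZMod m) * U (i + k - 1 - (j : ℕ)) := by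
    intro i
    have := congrArg (Int.cast : ℤ → ZMod m) (hrec i)
    push_cast at this
    exact this
  have back : ∀ x y : ℕ, (∀ t < k, (U (x + 1 + t) : ZMod m) = U (y + 1 + t)) →
      ∀ t < k, (U (x + t) : ZMod m) = U (y + t) := by
    intro x y h t ht
    have hz : (U x : ZMod m) = U y := by
      have e := h (k - 1) (by omega)
      rw [show x + 1 + (k - 1) = x + k by omega, show y + 1 + (k - 1) = y + k by omega,
        hrec', hrec'] at e
      have key := Finset.add_sum_erase Finset.univ
        (fun j : Fin k => ((a j : ℤ) : ZMod m) * U (x + k - 1 - (j : ℕ)))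
        (Finset.mem_univ (⟨k - 1, Nat.sub_lt hk Nat.one_pos⟩ : Fin k))
      have key' := Finset.add_sum_erase Finset.univ
        (fun j : Fin k => ((a j : ℤ) : ZMod m) * U (y + k - 1 - (j : ℕ)))
        (Finset.mem_univ (⟨k - 1, Nat.sub_lt hk Nat.one_pos⟩ : Fin k))
      rw [← key, ← key'] at e
      have hs : ∑ j ∈ Finset.univ.erase (⟨k - 1, Nat.sub_lt hk Nat.one_pos⟩ : Fin k),
            ((a j : ℤ) : ZMod m) * (U (x + k - 1 - (j : ℕ)) : ZMod m) =
          ∑ j ∈ Finset.univ.erase (⟨k - 1, Nat.sub_lt hk Nat.one_pos⟩ : Fin k),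
            ((a j : ℤ) : ZMod m) * (U (y + k - 1 - (j : ℕ)) : ZMod m) := by
        refine Finset.sum_congr rfl fun j hj => ?_
        have hj1 : (j : ℕ) ≠ k - 1 := fun hh =>
          (Finset.mem_erase.1 hj).1 (Fin.ext hh)
        have hj2 := j.2
        have := h (k - 2 - j) (by omega)
        rw [show x + 1 + (k - 2 - (j : ℕ)) = x + k - 1 - j by omega,
          show y + 1 + (k - 2 - (j : ℕ)) = y + k - 1 - j by omega] at this
        rw [this]
      rw [hs] at e
      have e2 := hu.mul_left_cancel (add_right_cancel e)
      simpa [show x + k - 1 - (k - 1) = x by omega,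
        show y + k - 1 - (k - 1) = y by omega] using e2
    rcases t with _ | t
    · simpa using hz
    · have := h t (by omega)
      rwa [show x + 1 + t = x + (t + 1) by omega,
        show y + 1 + t = y + (t + 1) by omega] at this
  have backn : ∀ n x y : ℕ, (∀ t < k, (U (x + n + t) : ZMod m) = U (y + n + t)) →
      ∀ t < k, (U (x + t) : ZMod m) = U (y + t) := by
    intro n
    induction n with
    | zero => intro x y h; simpa using h
    | succ n ih =>
      intro x y h
      exact ih x y (back (x + n) (y + n) h)
  intro N
  obtain ⟨n1, n2, hne, he⟩ := Finite.exists_ne_map_eq_of_infinite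
    (fun n : ℕ => fun t : Fin k => (U (i + n * N + t) : ZMod m))
  wlog hlt : n1 < n2 generalizing n1 n2
  · exact this n2 n1 hne.symm he.symm (by omega)
  obtain ⟨d, rfl⟩ := Nat.exists_eq_add_of_lt hlt
  refine ⟨i + (d + 1) * N, by nlinarith [Nat.zero_le (d * N)], ?_⟩
  have := backn (n1 * N) i (i + (d + 1) * N) (fun t ht => by
    have := congrFun he ⟨t, ht⟩
    simp only at this
    rw [this]
    congr 2
    ring) 0 hk
  simpa using this.symm

lemma le_Ninf_of_unit (U : ℕ → ℕ) (hmono : StrictMono U)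
    (k : ℕ) (hk : 0 < k) (a : Fin k → ℤ)
    (hrec : ∀ i : ℕ, (U (i + k) : ℤ) = ∑ j : Fin k, a j * U (i + k - 1 - (j : ℕ)))
    (m : ℕ) [NeZero m]
    (hu : IsUnit ((a ⟨k - 1, Nat.sub_lt hk Nat.one_pos⟩ : ℤ) : ZMod m)) (B : ℕ)
    (hB : U B ≤ m) : B ≤ Ninf U m := by
  classical
  have hinj : Set.InjOn (fun i => (U i : ZMod m)) (Finset.range B : Set ℕ) := by
    intro x hx y hy hxy
    have hx' : U x < m := lt_of_lt_of_le (hmono (by simpa using hx)) hB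
    have hy' : U y < m := lt_of_lt_of_le (hmono (by simpa using hy)) hB
    have := congrArg ZMod.val hxy
    simp only [ZMod.val_natCast, Nat.mod_eq_of_lt hx', Nat.mod_eq_of_lt hy'] at this
    exact hmono.injective this
  have hsub : (fun i => (U i : ZMod m)) '' (Finset.range B : Set ℕ) ⊆ infSet U m := by
    rintro _ ⟨i, -, rfl⟩
    exact mem_infSet_of_unit U k hk a hrec m hu i
  calc B = ((Finset.range B : Set ℕ)).ncard := by rw [Set.ncard_coe_finset, Finset.card_range]
    _ = ((fun i => (U i : ZMod m)) '' (Finset.range B : Set ℕ)).ncard :=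
        (Set.ncard_image_of_injOn hinj).symm
    _ ≤ (infSet U m).ncard := Set.ncard_le_ncard hsub (Set.toFinite _)
    _ = Ninf U m := rfl

lemma tendsto_of_primes (U : ℕ → ℕ) (hmono : StrictMono U)
    (k : ℕ) (hk : 0 < k) (a : Fin k → ℤ)
    (hak : a ⟨k - 1, Nat.sub_lt hk Nat.one_pos⟩ ≠ 0)
    (hrec : ∀ i : ℕ, (U (i + k) : ℤ) = ∑ j : Fin k, a j * U (i + k - 1 - (j : ℕ)))
    (h : ∀ p : ℕ, p.Prime → (p : ℤ) ∣ a ⟨k - 1, Nat.sub_lt hk Nat.one_pos⟩ →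
        Tendsto (fun v => Ninf U (p ^ v)) atTop atTop) :
    Tendsto (fun m => Ninf U m) atTop atTop := by
  rw [tendsto_atTop]
  intro B
  set A := a ⟨k - 1, Nat.sub_lt hk Nat.one_pos⟩ with hA
  have h' : ∀ p : ℕ, ∃ V : ℕ, p.Prime → (p : ℤ) ∣ A → ∀ v, V ≤ v → B ≤ Ninf U (p ^ v) := by
    intro p
    by_cases hp : p.Prime ∧ (p : ℤ) ∣ A
    · obtain ⟨V, hV⟩ := eventually_atTop.1 ((tendsto_atTop.1 (h p hp.1 hp.2)) B)
      exact ⟨V, fun _ _ v hv => hV v hv⟩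
    · exact ⟨0, fun h1 h2 => absurd ⟨h1, h2⟩ hp⟩
  choose V hV using h'
  set M := U B + A.natAbs.primeFactors.sup (fun p => p ^ V p) with hM
  refine eventually_atTop.2 ⟨M.factorial + 1, fun m hm => ?_⟩
  have hm0 : m ≠ 0 := by omega
  have hnd : ¬ m ∣ M.factorial := fun hd => by
    have := Nat.le_of_dvd (Nat.factorial_pos M) hd
    omega
  rw [Nat.dvd_iff_prime_pow_dvd_dvd] at hnd
  push Not at hnd
  obtain ⟨p, v, hp, hpm, hpM⟩ := hnd
  have hlt : M < p ^ v := by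
    by_contra hle
    exact hpM (Nat.dvd_factorial (pow_pos hp.pos v) (by omega))
  refine le_trans ?_ (Ninf_le_of_dvd U hpm hm0)
  by_cases hpA : (p : ℤ) ∣ A
  · refine hV p hp hpA v ?_
    have hmem : p ∈ A.natAbs.primeFactors :=
      Nat.mem_primeFactors.2 ⟨hp, Int.natCast_dvd.1 hpA, Int.natAbs_ne_zero.2 hak⟩
    have h1 : p ^ V p ≤ A.natAbs.primeFactors.sup (fun p => p ^ V p) :=
      Finset.le_sup (f := fun p => p ^ V p) hmem
    exact ((Nat.pow_lt_pow_iff_right hp.one_lt).1 (by omega : p ^ V p < p ^ v)).le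
  · haveI : NeZero (p ^ v) := ⟨(pow_pos hp.pos v).ne'⟩
    refine le_Ninf_of_unit U hmono k hk a hrec (p ^ v) ?_ B (by omega)
    rw [← hA, ZMod.coe_int_isUnit_iff_isCoprime]
    push_cast
    exact IsCoprime.pow_left (((Nat.prime_iff_prime_int.1 hp).coprime_iff_not_dvd).2 hpA)

/-- Let `U` be a strictly increasing sequence of positive integers satisfying a
linear recurrence `U_{i+k} = a_1 U_{i+k-1} + ⋯ + a_k U_i` of order `k` with
integer coefficients and `a_k ≠ 0` (here `a ⟨j⟩` is the coefficient `a_{j+1}`).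
Then `lim_{m→∞} N_U(m) = +∞` if and only if for every prime divisor `p` of
`a_k` one has `lim_{v→∞} N_U(p^v) = +∞`.  In particular, if `a_k = ±1` then
`lim_{m→∞} N_U(m) = +∞`. -/
theorem statement_10 (U : ℕ → ℕ) (hmono : StrictMono U) (hpos : ∀ i, 0 < U i)
    (k : ℕ) (hk : 0 < k) (a : Fin k → ℤ)
    (hak : a ⟨k - 1, Nat.sub_lt hk Nat.one_pos⟩ ≠ 0)
    (hrec : ∀ i : ℕ, (U (i + k) : ℤ) = ∑ j : Fin k, a j * U (i + k - 1 - (j : ℕ))) :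
    ((Tendsto (fun m => Ninf U m) atTop atTop) ↔
      (∀ p : ℕ, p.Prime → (p : ℤ) ∣ a ⟨k - 1, Nat.sub_lt hk Nat.one_pos⟩ →
        Tendsto (fun v => Ninf U (p ^ v)) atTop atTop)) ∧
    ((a ⟨k - 1, Nat.sub_lt hk Nat.one_pos⟩ = 1 ∨
        a ⟨k - 1, Nat.sub_lt hk Nat.one_pos⟩ = -1) →
      Tendsto (fun m => Ninf U m) atTop atTop) := by
  have main := tendsto_of_primes U hmono k hk a hak hrec
  refine ⟨⟨fun h p hp _ => h.comp (tendsto_pow_atTop_atTop_of_one_lt hp.one_lt), main⟩,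
    fun h1 => main fun p hp hd => ?_⟩
  exfalso
  have hd1 : (p : ℤ) ∣ 1 := by
    rcases h1 with h1 | h1
    · rwa [h1] at hd
    · rw [h1] at hd
      exact (dvd_neg.1 hd)
  exact (Nat.prime_iff_prime_int.1 hp).not_dvd_one hd1
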